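/- arXiv:2005.12664 — 5 statements merged into one kernel-verified Lean document; each statement's English description precedes it below -/
import Mathlib

section
/- Let 𝒜 be an additive category and suppose given chain maps f' : X' → Y', f : X → Y, u : X' → X, v : Y' → Y of cochain complexes in 𝒜, together with a chain homotopy F satisfying d F + F d = f∘u − v∘f'. If u and v are both chain homotopy equivalences, then the induced morphism F∗ : Cone(f') → Cone(f), given in degree i by the matrix (vⁱ, −Fⁱ; 0, u^{i+1}), is also a chain homotopy equivalence. -/
open CategoryTheory CategoryTheory.Limits

/-- A (cochain) complex in an additive category `𝒜`, indexed by `ℤ` with degree `+1`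
differentials. -/
structure Cplx (𝒜 : Type*) [Category 𝒜] [Preadditive 𝒜] where
  X : ℤ → 𝒜
  d : ∀ i : ℤ, X i ⟶ X (i + 1)
  d_comp_d : ∀ i : ℤ, d i ≫ d (i + 1) = 0

/-- A chain map between complexes. -/
structure ChainMap {𝒜 : Type*} [Category 𝒜] [Preadditive 𝒜] (C D : Cplx 𝒜) where
  f : ∀ i : ℤ, C.X i ⟶ D.X i
  comm : ∀ i : ℤ, f i ≫ D.d i = C.d i ≫ f (i + 1)

variable {𝒜 : Type*} [Category 𝒜] [Preadditive 𝒜] [HasFiniteBiproducts 𝒜]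

attribute [local instance] CategoryTheory.Limits.hasBinaryBiproducts_of_finite_biproducts

/-- The mapping cone of a chain map `f : X ⟶ Y`: in degree `i` it is `Yⁱ ⊞ X^{i+1}`, with
differential given by the matrix `(d_Y, f; 0, -d_X)`. -/
noncomputable def mappingCone {X Y : Cplx 𝒜} (f : ChainMap X Y) : Cplx 𝒜 where
  X i := Y.X i ⊞ X.X (i + 1)
  d i := Biprod.ofComponents (Y.d i) 0 (f.f (i + 1)) (-X.d (i + 1))
  d_comp_d i := by
    rw [Biprod.ofComponents_comp]
    have h1 : Y.d i ≫ Y.d (i + 1) = 0 := Y.d_comp_d i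
    have h2 : X.d (i + 1) ≫ X.d (i + 1 + 1) = 0 := X.d_comp_d (i + 1)
    have h3 := f.comm (i + 1)
    have : (Biprod.ofComponents (0 : Y.X i ⟶ Y.X (i+1+1)) (0 : Y.X i ⟶ X.X (i+1+1+1))
        (0 : X.X (i+1) ⟶ Y.X (i+1+1)) (0 : X.X (i+1) ⟶ X.X (i+1+1+1))) = 0 := by
      ext <;> simp [Biprod.ofComponents]
    rw [← this]
    congr 1 <;> simp [h1, h2, h3]

/-- The morphism `Cone(f') ⟶ Cone(f)` induced by a homotopy-commutative square: in degree `i`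
it is given by the matrix `(vⁱ, -F^{i+1}; 0, u^{i+1})`. -/
noncomputable def coneInduced {X' Y' X Y : Cplx 𝒜} (f' : ChainMap X' Y') (f : ChainMap X Y)
    (u : ChainMap X' X) (v : ChainMap Y' Y) (F : ∀ i : ℤ, X'.X (i + 1) ⟶ Y.X i) (i : ℤ) :
    (mappingCone f').X i ⟶ (mappingCone f).X i :=
  Biprod.ofComponents (v.f i) 0 (-F i) (u.f (i + 1))

/-- The identity chain map. -/
def ChainMap.id' (C : Cplx 𝒜) : ChainMap C C where
  f _ := 𝟙 _
  comm i := by simp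

/-- Composition of chain maps. -/
def ChainMap.comp' {C D E : Cplx 𝒜} (p : ChainMap C D) (q : ChainMap D E) : ChainMap C E where
  f i := p.f i ≫ q.f i
  comm i := by rw [Category.assoc, q.comm, ← Category.assoc, p.comm, Category.assoc]

/-- Two chain maps are chain homotopic if there is a chain homotopy between them. -/
def ChainHomotopic {C D : Cplx 𝒜} (p q : ChainMap C D) : Prop :=
  ∃ H : ∀ i : ℤ, C.X (i + 1) ⟶ D.X i,
    ∀ i : ℤ, H i ≫ D.d i + C.d (i + 1) ≫ H (i + 1) = q.f (i + 1) - p.f (i + 1)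

/-- A chain map is a chain homotopy equivalence if it has an inverse up to chain homotopy. -/
def IsChainHtpyEquiv {C D : Cplx 𝒜} (p : ChainMap C D) : Prop :=
  ∃ q : ChainMap D C,
    ChainHomotopic (p.comp' q) (ChainMap.id' C) ∧ ChainHomotopic (q.comp' p) (ChainMap.id' D)

theorem ChainMap.ext' {C D : Cplx 𝒜} {p q : ChainMap C D} (h : ∀ i, p.f i = q.f i) : p = q := by
  cases p; cases q
  congr
  funext i
  exact h i

theorem comp'_assoc {A B C D : Cplx 𝒜} (p : ChainMap A B) (q : ChainMap B C) (r : ChainMap C D) :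
    (p.comp' q).comp' r = p.comp' (q.comp' r) :=
  ChainMap.ext' fun i => by simp [ChainMap.comp']

theorem id'_comp' {A B : Cplx 𝒜} (p : ChainMap A B) : (ChainMap.id' A).comp' p = p :=
  ChainMap.ext' fun i => by simp [ChainMap.comp', ChainMap.id']

theorem comp'_id' {A B : Cplx 𝒜} (p : ChainMap A B) : p.comp' (ChainMap.id' B) = p :=
  ChainMap.ext' fun i => by simp [ChainMap.comp', ChainMap.id']

theorem ChainHomotopic.symm' {C D : Cplx 𝒜} {p q : ChainMap C D} (h : ChainHomotopic p q) :
    ChainHomotopic q p := by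
  obtain ⟨H, hH⟩ := h
  refine ⟨fun i => -H i, fun i => ?_⟩
  have := hH i
  simp only [Preadditive.neg_comp, Preadditive.comp_neg]
  rw [← neg_add, this, neg_sub]

theorem ChainHomotopic.trans' {C D : Cplx 𝒜} {p q r : ChainMap C D} (h : ChainHomotopic p q)
    (h' : ChainHomotopic q r) : ChainHomotopic p r := by
  obtain ⟨H, hH⟩ := h
  obtain ⟨K, hK⟩ := h'
  refine ⟨fun i => H i + K i, fun i => ?_⟩
  have h1 := hH i
  have h2 := hK i
  simp only [Preadditive.add_comp, Preadditive.comp_add]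
  rw [add_add_add_comm, h1, h2]
  abel

theorem ChainHomotopic.left {B C D : Cplx 𝒜} {p q : ChainMap C D} (r : ChainMap B C)
    (h : ChainHomotopic p q) : ChainHomotopic (r.comp' p) (r.comp' q) := by
  obtain ⟨H, hH⟩ := h
  refine ⟨fun i => r.f (i + 1) ≫ H i, fun i => ?_⟩
  simp only [ChainMap.comp', ← Preadditive.comp_sub]
  rw [← hH i, ← Category.assoc (B.d _), ← r.comm]
  simp

theorem ChainHomotopic.right {C D E : Cplx 𝒜} {p q : ChainMap C D} (r : ChainMap D E)
    (h : ChainHomotopic p q) : ChainHomotopic (p.comp' r) (q.comp' r) := by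
  obtain ⟨H, hH⟩ := h
  refine ⟨fun i => H i ≫ r.f i, fun i => ?_⟩
  simp only [ChainMap.comp', ← Preadditive.sub_comp]
  rw [← hH i, Category.assoc, r.comm]
  simp

theorem equiv_of_inverses {C D : Cplx 𝒜} (p : ChainMap C D) (q r : ChainMap D C)
    (hq : ChainHomotopic (p.comp' q) (ChainMap.id' C))
    (hr : ChainHomotopic (r.comp' p) (ChainMap.id' D)) : IsChainHtpyEquiv p := by
  refine ⟨q, hq, ?_⟩
  have h1 : ChainHomotopic ((r.comp' p).comp' q) q := by
    simpa only [id'_comp'] using hr.right q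
  have h2 : ChainHomotopic ((r.comp' p).comp' q) r := by
    simpa only [comp'_id', comp'_assoc] using hq.left r
  exact ((h1.symm'.trans' h2).right p).trans' hr

theorem two_of_six {C D : Cplx 𝒜} (p : ChainMap C D) (q : ChainMap D C)
    (h1 : IsChainHtpyEquiv (p.comp' q)) (h2 : IsChainHtpyEquiv (q.comp' p)) :
    IsChainHtpyEquiv p := by
  obtain ⟨r, hr, -⟩ := h1
  obtain ⟨s, -, hs⟩ := h2
  refine equiv_of_inverses p (q.comp' r) (s.comp' q) ?_ ?_
  · rwa [← comp'_assoc]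
  · rwa [comp'_assoc]

theorem ofC_add {A B C D : 𝒜} (a a' : A ⟶ C) (b b' : A ⟶ D) (c c' : B ⟶ C) (d d' : B ⟶ D) :
    Biprod.ofComponents a b c d + Biprod.ofComponents a' b' c' d' =
      Biprod.ofComponents (a + a') (b + b') (c + c') (d + d') := by
  ext <;> simp

theorem ofC_sub {A B C D : 𝒜} (a a' : A ⟶ C) (b b' : A ⟶ D) (c c' : B ⟶ C) (d d' : B ⟶ D) :
    Biprod.ofComponents a b c d - Biprod.ofComponents a' b' c' d' =
      Biprod.ofComponents (a - a') (b - b') (c - c') (d - d') := by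
  ext <;> simp

theorem ofC_htpy {A B C D A' B' C' D' : 𝒜}
    (a : A ⟶ C) (d : B ⟶ D) (p : C ⟶ A') (q : D ⟶ A') (r : D ⟶ B')
    (p' : A ⟶ C') (q' : B ⟶ C') (r' : B ⟶ D') (a' : C' ⟶ A') (d' : D' ⟶ B')
    (x y : A ⟶ A') (z w : B ⟶ A') (s t : B ⟶ B')
    (h1 : a ≫ p + p' ≫ a' = x - y) (h2 : d ≫ q + q' ≫ a' = z - w)
    (h3 : d ≫ r + r' ≫ d' = s - t) :
    Biprod.ofComponents a 0 0 d ≫ Biprod.ofComponents p 0 q r +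
      Biprod.ofComponents p' 0 q' r' ≫ Biprod.ofComponents a' 0 0 d' =
    Biprod.ofComponents x 0 z s - Biprod.ofComponents y 0 w t := by
  rw [Biprod.ofComponents_comp, Biprod.ofComponents_comp, ofC_add, ofC_sub, ← h1, ← h2, ← h3]
  simp

theorem ofC_one (A B : 𝒜) : 𝟙 (A ⊞ B) = Biprod.ofComponents (𝟙 A) 0 0 (𝟙 B) := by
  ext <;> simp

def Sq {X' Y' X Y : Cplx 𝒜} (f' : ChainMap X' Y') (f : ChainMap X Y)
    (u : ChainMap X' X) (v : ChainMap Y' Y) (F : ∀ i : ℤ, X'.X (i + 1) ⟶ Y.X i) : Prop :=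
  ∀ i : ℤ, F i ≫ Y.d i + X'.d (i + 1) ≫ F (i + 1)
      = u.f (i + 1) ≫ f.f (i + 1) - f'.f (i + 1) ≫ v.f (i + 1)

theorem coneMap_comm {X' Y' X Y : Cplx 𝒜} (f' : ChainMap X' Y') (f : ChainMap X Y)
    (u : ChainMap X' X) (v : ChainMap Y' Y)
    (F : ∀ i : ℤ, X'.X (i + 1) ⟶ Y.X i) (hF : Sq f' f u v F) (i : ℤ) :
    coneInduced f' f u v F i ≫ (mappingCone f).d i
        = (mappingCone f').d i ≫ coneInduced f' f u v F (i + 1) := by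
  change Biprod.ofComponents _ _ _ _ ≫ Biprod.ofComponents _ _ _ _ =
    Biprod.ofComponents _ _ _ _ ≫ Biprod.ofComponents _ _ _ _
  rw [Biprod.ofComponents_comp, Biprod.ofComponents_comp]
  have h := hF i
  have h1 := v.comm i
  have h2 := u.comm (i + 1)
  congr 1
  · simp [h1]
  · simp
  · simp only [Preadditive.neg_comp, Preadditive.comp_neg, neg_neg]
    linear_combination (norm := abel) -h
  · simp [h2]

noncomputable def coneMap {X' Y' X Y : Cplx 𝒜} (f' : ChainMap X' Y') (f : ChainMap X Y)
    (u : ChainMap X' X) (v : ChainMap Y' Y)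
    (F : ∀ i : ℤ, X'.X (i + 1) ⟶ Y.X i) (hF : Sq f' f u v F) :
    ChainMap (mappingCone f') (mappingCone f) :=
  ⟨fun i => coneInduced f' f u v F i, coneMap_comm f' f u v F hF⟩

theorem compSq {X Y X' Y' X'' Y'' : Cplx 𝒜} (f : ChainMap X Y) (f' : ChainMap X' Y')
    (f'' : ChainMap X'' Y'')
    (u : ChainMap X X') (v : ChainMap Y Y') (F : ∀ i : ℤ, X.X (i + 1) ⟶ Y'.X i)
    (hF : Sq f f' u v F)
    (a : ChainMap X' X'') (b : ChainMap Y' Y'') (G : ∀ i : ℤ, X'.X (i + 1) ⟶ Y''.X i)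
    (hG : Sq f' f'' a b G) :
    Sq f f'' (u.comp' a) (v.comp' b) (fun i => F i ≫ b.f i + u.f (i + 1) ≫ G i) := by
  intro i
  have h1 := congrArg (· ≫ b.f (i + 1)) (hF i)
  have h2 := congrArg (u.f (i + 1) ≫ ·) (hG i)
  have h3 := b.comm i
  have h4 := congrArg (· ≫ G (i + 1)) (u.comm (i + 1))
  simp only [ChainMap.comp', Preadditive.add_comp, Preadditive.comp_add, Preadditive.sub_comp,
    Preadditive.comp_sub, Category.assoc] at h1 h2 h3 h4 ⊢
  rw [h3, ← h4]
  linear_combination (norm := abel) h1 + h2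

theorem coneMap_comp {X Y X' Y' X'' Y'' : Cplx 𝒜} (f : ChainMap X Y) (f' : ChainMap X' Y')
    (f'' : ChainMap X'' Y'')
    (u : ChainMap X X') (v : ChainMap Y Y') (F : ∀ i : ℤ, X.X (i + 1) ⟶ Y'.X i)
    (hF : Sq f f' u v F)
    (a : ChainMap X' X'') (b : ChainMap Y' Y'') (G : ∀ i : ℤ, X'.X (i + 1) ⟶ Y''.X i)
    (hG : Sq f' f'' a b G) :
    (coneMap f f' u v F hF).comp' (coneMap f' f'' a b G hG) =
    coneMap f f'' (u.comp' a) (v.comp' b) (fun i => F i ≫ b.f i + u.f (i + 1) ≫ G i)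
      (compSq f f' f'' u v F hF a b G hG) := by
  refine ChainMap.ext' fun i => ?_
  change Biprod.ofComponents _ _ _ _ ≫ Biprod.ofComponents _ _ _ _ =
    Biprod.ofComponents _ _ _ _
  rw [Biprod.ofComponents_comp]
  congr 1 <;> simp [ChainMap.comp']
  abel

theorem invSq {X' Y' X Y : Cplx 𝒜} (f' : ChainMap X' Y') (f : ChainMap X Y)
    (u : ChainMap X' X) (v : ChainMap Y' Y)
    (F : ∀ i : ℤ, X'.X (i + 1) ⟶ Y.X i) (hF : Sq f' f u v F)
    (a : ChainMap X X') (b : ChainMap Y Y')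
    (k : ∀ i : ℤ, X.X (i + 1) ⟶ X.X i) (h : ∀ i : ℤ, Y'.X (i + 1) ⟶ Y'.X i)
    (hk : ∀ i : ℤ, k i ≫ X.d i + X.d (i + 1) ≫ k (i + 1)
      = (ChainMap.id' X).f (i + 1) - (a.comp' u).f (i + 1))
    (hh : ∀ i : ℤ, h i ≫ Y'.d i + Y'.d (i + 1) ≫ h (i + 1)
      = (ChainMap.id' Y').f (i + 1) - (v.comp' b).f (i + 1)) :
    Sq f f' a b (fun i => a.f (i + 1) ≫ f'.f (i + 1) ≫ h i - a.f (i + 1) ≫ F i ≫ b.f i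
      - k i ≫ f.f i ≫ b.f i) := by
  intro i
  have h1 := congrArg (fun t => a.f (i + 1) ≫ f'.f (i + 1) ≫ t) (hh i)
  have h2 := congrArg (fun t => a.f (i + 1) ≫ t ≫ b.f (i + 1)) (hF i)
  have h3 := congrArg (fun t => t ≫ f.f (i + 1) ≫ b.f (i + 1)) (hk i)
  have e1 := b.comm i
  have e2 := congrArg (· ≫ b.f (i + 1)) (f.comm i)
  have e3 := congrArg (· ≫ f'.f (i + 1 + 1) ≫ h (i + 1)) (a.comm (i + 1))
  have e4 := congrArg (fun t => a.f (i + 1) ≫ t ≫ h (i + 1)) (f'.comm (i + 1))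
  have e5 := congrArg (· ≫ F (i + 1) ≫ b.f (i + 1)) (a.comm (i + 1))
  simp only [ChainMap.comp', ChainMap.id', Preadditive.add_comp, Preadditive.comp_add,
    Preadditive.sub_comp, Category.id_comp, Category.comp_id,
    Preadditive.comp_sub, Category.assoc] at h1 h2 h3 e1 e2 e3 e4 e5 ⊢
  rw [e1, e2, ← e3, ← e5, ← e4]
  linear_combination (norm := abel) h1 - h2 - h3

theorem homotopic_self {C D : Cplx 𝒜} (p : ChainMap C D) : ChainHomotopic p p :=
  ⟨fun _ => 0, fun i => by simp⟩

theorem homotopic_of_eq {C D : Cplx 𝒜} {p q : ChainMap C D} (h : p = q) : ChainHomotopic p q :=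
  h ▸ homotopic_self p

theorem coneMap_equiv_one {X Y : Cplx 𝒜} (f : ChainMap X Y)
    (K : ∀ i : ℤ, X.X (i + 1) ⟶ Y.X i) (hK : Sq f f (ChainMap.id' X) (ChainMap.id' Y) K) :
    IsChainHtpyEquiv (coneMap f f _ _ K hK) := by
  have hK' : Sq f f (ChainMap.id' X) (ChainMap.id' Y) (fun i => - K i) := by
    intro i
    have := hK i
    simp only [ChainMap.id', Category.id_comp, Category.comp_id, sub_self, Preadditive.neg_comp,
      Preadditive.comp_neg] at this ⊢
    rw [← neg_add, this, neg_zero]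
  refine ⟨coneMap f f _ _ _ hK', ?_, ?_⟩
  all_goals
    rw [coneMap_comp]
    refine homotopic_of_eq (ChainMap.ext' fun i => ?_)
    symm
    change 𝟙 (_ ⊞ _) = Biprod.ofComponents _ _ _ _
    rw [ofC_one]
    congr 1 <;> simp [ChainMap.comp', ChainMap.id']

theorem coneMap_equiv {X Y : Cplx 𝒜} (f : ChainMap X Y)
    (u : ChainMap X X) (v : ChainMap Y Y)
    (F : ∀ i : ℤ, X.X (i + 1) ⟶ Y.X i) (hF : Sq f f u v F)
    (hu : ChainHomotopic u (ChainMap.id' X)) (hv : ChainHomotopic v (ChainMap.id' Y)) :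
    IsChainHtpyEquiv (coneMap f f u v F hF) := by
  obtain ⟨k, hk⟩ := hu
  obtain ⟨h, hh⟩ := hv
  have hK : Sq f f (ChainMap.id' X) (ChainMap.id' Y)
      (fun i => F i + k i ≫ f.f i - f.f (i + 1) ≫ h i) := by
    intro i
    have h1 := hF i
    have h2 := congrArg (· ≫ f.f (i + 1)) (hk i)
    have h3 := congrArg (f.f (i + 1) ≫ ·) (hh i)
    have e1 := f.comm i
    have e2 := congrArg (· ≫ h (i + 1)) (f.comm (i + 1))
    simp only [ChainMap.id', Preadditive.add_comp, Preadditive.comp_add,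
      Preadditive.sub_comp, Category.id_comp, Category.comp_id,
      Preadditive.comp_sub, Category.assoc] at h1 h2 h3 e1 e2 ⊢
    rw [e1, ← e2]
    linear_combination (norm := abel) h1 + h2 - h3
  have key : ChainHomotopic (coneMap f f u v F hF) (coneMap f f _ _ _ hK) := by
    refine ⟨fun i => Biprod.ofComponents (h i) 0 0 (-k (i + 1)), fun i => ?_⟩
    refine ofC_htpy _ _ _ _ _ _ _ _ _ _ _ _ _ _ _ _ (hh i) ?_ ?_
    · simp only [Preadditive.neg_comp]
      abel
    · simpa using hk (i + 1)
  obtain ⟨q, hq, hq'⟩ := coneMap_equiv_one f _ hK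
  exact ⟨q, (key.right q).trans' hq, (key.left q).trans' hq'⟩

theorem statement3 {X' Y' X Y : Cplx 𝒜} (f' : ChainMap X' Y') (f : ChainMap X Y)
    (u : ChainMap X' X) (v : ChainMap Y' Y)
    (F : ∀ i : ℤ, X'.X (i + 1) ⟶ Y.X i)
    -- `F` is a chain homotopy with `d F + F d = f ∘ u - v ∘ f'`
    (hF : ∀ i : ℤ, F i ≫ Y.d i + X'.d (i + 1) ≫ F (i + 1)
      = u.f (i + 1) ≫ f.f (i + 1) - f'.f (i + 1) ≫ v.f (i + 1))
    -- `u` and `v` are chain homotopy equivalences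
    (hu : IsChainHtpyEquiv u) (hv : IsChainHtpyEquiv v) :
    -- then the induced morphism `F∗ : Cone(f') ⟶ Cone(f)` is a chain map and a
    -- chain homotopy equivalence
    ∃ hcomm : ∀ i : ℤ, coneInduced f' f u v F i ≫ (mappingCone f).d i
        = (mappingCone f').d i ≫ coneInduced f' f u v F (i + 1),
      IsChainHtpyEquiv (⟨fun i => coneInduced f' f u v F i, hcomm⟩ :
        ChainMap (mappingCone f') (mappingCone f)) := by
  refine ⟨coneMap_comm f' f u v F hF, ?_⟩
  obtain ⟨a, hk, ⟨k', hk'⟩⟩ := hu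
  obtain ⟨b, ⟨h, hh⟩, hh'⟩ := hv
  have hG := invSq f' f u v F hF a b k' h hk' hh
  have e1 := coneMap_equiv f' (u.comp' a) (v.comp' b) _ (compSq f' f f' u v F hF a b _ hG) hk ⟨h, hh⟩
  have e2 := coneMap_equiv f (a.comp' u) (b.comp' v) _ (compSq f f' f a b _ hG u v F hF) ⟨k', hk'⟩ hh'
  rw [← coneMap_comp f' f f' u v F hF a b _ hG] at e1
  rw [← coneMap_comp f f' f a b _ hG u v F hF] at e2
  exact two_of_six (coneMap f' f u v F hF) _ e1 e2
end

section
/- Let 𝒜 be an additive category and suppose given chain maps f' : X' → Y', g' : Y' → Z', f : X → Y, g : Y → Z, u : X' → X, v : Y' → Y, w : Z' → Z with g∘f = 0 and g'∘f' = 0, chain homotopies F (with d F + F d = f∘u − v∘f') and G (with d G + G d = g∘v − w∘g'), and a family Ψ = {Ψⁱ : X'ⁱ → Z^{i−2}} satisfying d Ψ − Ψ d = g∘F + G∘f'. Let f̄ : X → Cone(g)[1] be the chain map given in degree i by (0, fⁱ) : Xⁱ → Z^{i−1} ⊕ Yⁱ (using g∘f = 0), define f̄' : X' → Cone(g')[1]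 similarly, and let G∗ : Cone(g')[1] → Cone(g)[1] be the chain map given in degree i by the matrix (w^{i−1}, −G^i; 0, v^i) : Z'^{i−1} ⊕ Y'ⁱ → Z^{i−1} ⊕ Yⁱ. Then the family F̄ⁱ := (−Ψⁱ, Fⁱ) : X'ⁱ → Z^{i−2} ⊕ Y^{i−1} is a chain homotopy with d F̄ + F̄ d = f̄∘u − G∗∘f̄'. -/
open CategoryTheory CategoryTheory.Limits

variable {𝒜 : Type*} [Category 𝒜] [Preadditive 𝒜] [HasFiniteBiproducts 𝒜]

attribute [local instance] CategoryTheory.Limits.hasBinaryBiproducts_of_finite_biproducts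

/-- The components of the chain map `f̄ : X ⟶ Cone(g)[1]` induced by `f : X ⟶ Y` with
`g ∘ f = 0`: in degree `i+1` it is `(0, f^{i+1}) : X^{i+1} ⟶ Zⁱ ⊞ Y^{i+1} = (Cone(g)[1])^{i+1}`.
(We use that `Cone(g)[1]^{j} = Cone(g)^{j-1}` and `d_{Cone(g)[1]}^{j} = -d_{Cone(g)}^{j-1}`.) -/
noncomputable def toConeShift {X Y Z : Cplx 𝒜} (g : ChainMap Y Z) (f : ChainMap X Y) (i : ℤ) :
    X.X (i + 1) ⟶ (mappingCone g).X i :=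
  biprod.lift 0 (f.f (i + 1))

/-- The components of the chain map `G∗ : Cone(g')[1] ⟶ Cone(g)[1]` induced by `G`: in degree
`i+1` it is the matrix `(wⁱ, -G^{i+1}; 0, v^{i+1}) : Z'ⁱ ⊞ Y'^{i+1} ⟶ Zⁱ ⊞ Y^{i+1}`. -/
noncomputable def coneShiftInduced {Y' Z' Y Z : Cplx 𝒜} (g' : ChainMap Y' Z')
    (g : ChainMap Y Z) (v : ChainMap Y' Y) (w : ChainMap Z' Z)
    (G : ∀ i : ℤ, Y'.X (i + 1) ⟶ Z.X i) (i : ℤ) :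
    (mappingCone g').X i ⟶ (mappingCone g).X i :=
  Biprod.ofComponents (w.f i) 0 (-G i) (v.f (i + 1))

/-- The degree `-1` family `F̄ⁱ = (-Ψⁱ, Fⁱ) : X'ⁱ ⟶ Z^{i-2} ⊞ Y^{i-1} = (Cone(g)[1])^{i-1}`. -/
noncomputable def fbarHtpy {X' Y Z : Cplx 𝒜} (g : ChainMap Y Z)
    (Ψ : ∀ i : ℤ, X'.X (i + 1 + 1) ⟶ Z.X i) (F : ∀ i : ℤ, X'.X (i + 1) ⟶ Y.X i) (i : ℤ) :
    X'.X (i + 1 + 1) ⟶ (mappingCone g).X i :=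
  biprod.lift (-Ψ i) (F (i + 1))

theorem aux_lift {A B Z₀ Y₀ Z₁ Y₁ : 𝒜} (a : A ⟶ Y₀) (dz : Z₀ ⟶ Z₁) (g : Y₀ ⟶ Z₁) (dy : Y₀ ⟶ Y₁)
    (d : A ⟶ B) (b : B ⟶ Y₁) (h1 : a ≫ g = 0) (h2 : a ≫ dy = d ≫ b) :
    biprod.lift (0 : A ⟶ Z₀) a ≫ (-(Biprod.ofComponents dz 0 g (-dy)))
      = d ≫ biprod.lift 0 b := by
  apply biprod.hom_ext <;> simp [Biprod.ofComponents, h1, h2]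

theorem aux_map {P₀ Q₀ P₁ Q₁ Z₀ Y₀ Z₁ Y₁ : 𝒜} (dz : Z₀ ⟶ Z₁) (g : Y₀ ⟶ Z₁) (dy : Y₀ ⟶ Y₁)
    (dp : P₀ ⟶ P₁) (g' : Q₀ ⟶ P₁) (dq : Q₀ ⟶ Q₁) (w₀ : P₀ ⟶ Z₀) (w₁ : P₁ ⟶ Z₁)
    (v₀ : Q₀ ⟶ Y₀) (v₁ : Q₁ ⟶ Y₁) (G₀ : Q₀ ⟶ Z₀) (G₁ : Q₁ ⟶ Z₁)
    (h1 : G₀ ≫ dz + dq ≫ G₁ = v₀ ≫ g - g' ≫ w₁) (h2 : w₀ ≫ dz = dp ≫ w₁)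
    (h3 : v₀ ≫ dy = dq ≫ v₁) :
    Biprod.ofComponents w₀ 0 (-G₀) v₀ ≫ (-(Biprod.ofComponents dz 0 g (-dy)))
      = (-(Biprod.ofComponents dp 0 g' (-dq))) ≫ Biprod.ofComponents w₁ 0 (-G₁) v₁ := by
  have h4 : G₀ ≫ dz = v₀ ≫ g - g' ≫ w₁ - dq ≫ G₁ := by rw [← h1]; abel
  apply biprod.hom_ext <;> apply biprod.hom_ext'
  · simp [Biprod.ofComponents, h2]
  · simp [Biprod.ofComponents, h4]
    abel
  · simp [Biprod.ofComponents]
  · simp [Biprod.ofComponents, h3]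
    try abel

theorem aux_htpy {A B C Q P Z₀ Y₀ Z₁ Y₁ : 𝒜} (dz : Z₀ ⟶ Z₁) (g : Y₀ ⟶ Z₁) (dy : Y₀ ⟶ Y₁)
    (ψ₀ : A ⟶ Z₀) (F₀ : A ⟶ Y₀) (d : A ⟶ B) (ψ₁ : B ⟶ Z₁) (F₁ : B ⟶ Y₁) (u : A ⟶ C)
    (f : C ⟶ Y₁) (f' : A ⟶ Q) (w : P ⟶ Z₁) (G : Q ⟶ Z₁) (v : Q ⟶ Y₁)
    (h1 : ψ₀ ≫ dz - d ≫ ψ₁ = F₀ ≫ g + f' ≫ G)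
    (h2 : F₀ ≫ dy + d ≫ F₁ = u ≫ f - f' ≫ v) :
    biprod.lift (-ψ₀) F₀ ≫ (-(Biprod.ofComponents dz 0 g (-dy))) + d ≫ biprod.lift (-ψ₁) F₁
      = u ≫ biprod.lift 0 f - biprod.lift 0 f' ≫ Biprod.ofComponents w 0 (-G) v := by
  have h3 : ψ₀ ≫ dz = F₀ ≫ g + f' ≫ G + d ≫ ψ₁ := by rw [← h1]; abel
  apply biprod.hom_ext
  · simp [Biprod.ofComponents, h3]
    try abel
  · simp [Biprod.ofComponents, h2]

theorem statement5 {X' Y' Z' X Y Z : Cplx 𝒜} (f' : ChainMap X' Y') (g' : ChainMap Y' Z')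
    (f : ChainMap X Y) (g : ChainMap Y Z)
    (u : ChainMap X' X) (v : ChainMap Y' Y) (w : ChainMap Z' Z)
    -- `g ∘ f = 0` and `g' ∘ f' = 0`
    (hgf : ∀ i : ℤ, f.f i ≫ g.f i = 0) (hgf' : ∀ i : ℤ, f'.f i ≫ g'.f i = 0)
    (F : ∀ i : ℤ, X'.X (i + 1) ⟶ Y.X i)
    -- `F` is a chain homotopy with `d F + F d = f ∘ u - v ∘ f'`
    (hF : ∀ i : ℤ, F i ≫ Y.d i + X'.d (i + 1) ≫ F (i + 1)
      = u.f (i + 1) ≫ f.f (i + 1) - f'.f (i + 1) ≫ v.f (i + 1))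
    (G : ∀ i : ℤ, Y'.X (i + 1) ⟶ Z.X i)
    -- `G` is a chain homotopy with `d G + G d = g ∘ v - w ∘ g'`
    (hG : ∀ i : ℤ, G i ≫ Z.d i + Y'.d (i + 1) ≫ G (i + 1)
      = v.f (i + 1) ≫ g.f (i + 1) - g'.f (i + 1) ≫ w.f (i + 1))
    (Ψ : ∀ i : ℤ, X'.X (i + 1 + 1) ⟶ Z.X i)
    -- `Ψ` satisfies `d Ψ - Ψ d = g ∘ F + G ∘ f'`
    (hΨ : ∀ i : ℤ, Ψ i ≫ Z.d i - X'.d (i + 1 + 1) ≫ Ψ (i + 1)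
      = F (i + 1) ≫ g.f (i + 1) + f'.f (i + 1 + 1) ≫ G (i + 1)) :
    -- `f̄ : X ⟶ Cone(g)[1]` is a chain map
    (∀ i : ℤ, toConeShift g f i ≫ (-(mappingCone g).d i)
        = X.d (i + 1) ≫ toConeShift g f (i + 1)) ∧
    -- `f̄' : X' ⟶ Cone(g')[1]` is a chain map
    (∀ i : ℤ, toConeShift g' f' i ≫ (-(mappingCone g').d i)
        = X'.d (i + 1) ≫ toConeShift g' f' (i + 1)) ∧
    -- `G∗ : Cone(g')[1] ⟶ Cone(g)[1]` is a chain map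
    (∀ i : ℤ, coneShiftInduced g' g v w G i ≫ (-(mappingCone g).d i)
        = (-(mappingCone g').d i) ≫ coneShiftInduced g' g v w G (i + 1)) ∧
    -- and `F̄ⁱ = (-Ψⁱ, Fⁱ)` is a chain homotopy with `d F̄ + F̄ d = f̄ ∘ u - G∗ ∘ f̄'`
    (∀ i : ℤ, fbarHtpy g Ψ F i ≫ (-(mappingCone g).d i)
        + X'.d (i + 1 + 1) ≫ fbarHtpy g Ψ F (i + 1)
      = u.f (i + 1 + 1) ≫ toConeShift g f (i + 1)
        - toConeShift g' f' (i + 1) ≫ coneShiftInduced g' g v w G (i + 1)) := by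
  exact ⟨fun i => aux_lift _ _ _ _ _ _ (hgf (i + 1)) (f.comm (i + 1)),
    fun i => aux_lift _ _ _ _ _ _ (hgf' (i + 1)) (f'.comm (i + 1)),
    fun i => aux_map _ _ _ _ _ _ _ _ _ _ _ _ (hG i) (w.comm i) (v.comm (i + 1)),
    fun i => aux_htpy _ _ _ _ _ _ _ _ _ _ _ _ _ _ (hΨ i) (hF (i + 1))⟩
end

section
/- Let 𝒜 be an additive category and suppose given chain maps f' : X' → Y', g' : Y' → Z', h' : Z' → W', f : X → Y, g : Y → Z, h : Z → W with g∘f = 0, h∘g = 0, g'∘f' = 0, h'∘g' = 0, vertical chain maps u : X' → X, v : Y' → Y, w : Z' → Z, s : W' → W, and chain homotopies F, G, H with d F + F d = f∘u − v∘f', d G + G d = g∘v − w∘g', d H + H d = h∘w − s∘h'. Assume further: (i) families Ψ = {Ψⁱ : X'ⁱ → Z^{i−2}} and Ξ = {Ξⁱ : Y'ⁱ → W^{i−2}} with d Ψ − Ψ d = g∘F + G∘f' and d Ξ − Ξ d = h∘G + H∘g'; (ii) a family Γ = {Γⁱ : X'ⁱ → W^{i−3}} with d Γ + Γ d = h∘Ψ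 − Ξ∘f'. Let c : Cone(f) → Cone(h)[1] be the canonical chain map given in degree i by (y, x) ↦ (0, g(y)) : Yⁱ ⊕ X^{i+1} → W^{i−1} ⊕ Zⁱ, and define c' : Cone(f') → Cone(h')[1] likewise; let F∗ : Cone(f') → Cone(f) be induced by F (matrix (v, −F; 0, u)) and H∗ : Cone(h')[1] → Cone(h)[1] be induced by H (matrix (s, −H; 0, w)). Then the family Γ∗ⁱ := (−Ξⁱ, Γ^{i+1}; Gⁱ, −Ψ^{i+1}) : Y'ⁱ ⊕ X'^{i+1} → W^{i−2} ⊕ Z^{i−1} is a chain homotopy with d Γ∗ + Γ∗ d = c∘F∗ − H∗∘c'. -/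
open CategoryTheory CategoryTheory.Limits

variable {𝒜 : Type*} [Category 𝒜] [Preadditive 𝒜] [HasFiniteBiproducts 𝒜]

attribute [local instance] CategoryTheory.Limits.hasBinaryBiproducts_of_finite_biproducts

/-- The components of the canonical chain map `c : Cone(f) ⟶ Cone(h)[1]`,
`(y, x) ↦ (0, g y)`: in degree `i+1` it is the matrix
`(0, g^{i+1}; 0, 0) : Y^{i+1} ⊞ X^{i+2} ⟶ Wⁱ ⊞ Z^{i+1}`. -/
noncomputable def coneToConeShift {X Y Z W : Cplx 𝒜} (f : ChainMap X Y) (g : ChainMap Y Z)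
    (h : ChainMap Z W) (i : ℤ) :
    (mappingCone f).X (i + 1) ⟶ (mappingCone h).X i :=
  Biprod.ofComponents 0 (g.f (i + 1)) 0 0

/-- The degree `-1` family
`Γ∗ⁱ = (-Ξⁱ, Γ^{i+1}; Gⁱ, -Ψ^{i+1}) : Y'ⁱ ⊞ X'^{i+1} ⟶ W^{i-2} ⊞ Z^{i-1}`. -/
noncomputable def gammaHtpy {X' Y' Z W : Cplx 𝒜} (f' : ChainMap X' Y')
    (h : ChainMap Z W)
    (G : ∀ i : ℤ, Y'.X (i + 1) ⟶ Z.X i) (Ψ : ∀ i : ℤ, X'.X (i + 1 + 1) ⟶ Z.X i)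
    (Ξ : ∀ i : ℤ, Y'.X (i + 1 + 1) ⟶ W.X i) (Γ : ∀ i : ℤ, X'.X (i + 1 + 1 + 1) ⟶ W.X i)
    (i : ℤ) : (mappingCone f').X (i + 1 + 1) ⟶ (mappingCone h).X i :=
  Biprod.ofComponents (-Ξ i) (G (i + 1)) (Γ i) (-Ψ (i + 1))

theorem statement6 {X' Y' Z' W' X Y Z W : Cplx 𝒜} (f' : ChainMap X' Y')
    (g' : ChainMap Y' Z') (h' : ChainMap Z' W')
    (f : ChainMap X Y) (g : ChainMap Y Z) (h : ChainMap Z W)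
    (u : ChainMap X' X) (v : ChainMap Y' Y) (w : ChainMap Z' Z) (s : ChainMap W' W)
    -- zero composites
    (hgf : ∀ i : ℤ, f.f i ≫ g.f i = 0) (hhg : ∀ i : ℤ, g.f i ≫ h.f i = 0)
    (hgf' : ∀ i : ℤ, f'.f i ≫ g'.f i = 0) (hhg' : ∀ i : ℤ, g'.f i ≫ h'.f i = 0)
    (F : ∀ i : ℤ, X'.X (i + 1) ⟶ Y.X i)
    -- `F` is a chain homotopy with `d F + F d = f ∘ u - v ∘ f'`
    (hF : ∀ i : ℤ, F i ≫ Y.d i + X'.d (i + 1) ≫ F (i + 1)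
      = u.f (i + 1) ≫ f.f (i + 1) - f'.f (i + 1) ≫ v.f (i + 1))
    (G : ∀ i : ℤ, Y'.X (i + 1) ⟶ Z.X i)
    -- `G` is a chain homotopy with `d G + G d = g ∘ v - w ∘ g'`
    (hG : ∀ i : ℤ, G i ≫ Z.d i + Y'.d (i + 1) ≫ G (i + 1)
      = v.f (i + 1) ≫ g.f (i + 1) - g'.f (i + 1) ≫ w.f (i + 1))
    (H : ∀ i : ℤ, Z'.X (i + 1) ⟶ W.X i)
    -- `H` is a chain homotopy with `d H + H d = h ∘ w - s ∘ h'`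
    (hH : ∀ i : ℤ, H i ≫ W.d i + Z'.d (i + 1) ≫ H (i + 1)
      = w.f (i + 1) ≫ h.f (i + 1) - h'.f (i + 1) ≫ s.f (i + 1))
    (Ψ : ∀ i : ℤ, X'.X (i + 1 + 1) ⟶ Z.X i)
    -- `Ψ` satisfies `d Ψ - Ψ d = g ∘ F + G ∘ f'`
    (hΨ : ∀ i : ℤ, Ψ i ≫ Z.d i - X'.d (i + 1 + 1) ≫ Ψ (i + 1)
      = F (i + 1) ≫ g.f (i + 1) + f'.f (i + 1 + 1) ≫ G (i + 1))
    (Ξ : ∀ i : ℤ, Y'.X (i + 1 + 1) ⟶ W.X i)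
    -- `Ξ` satisfies `d Ξ - Ξ d = h ∘ G + H ∘ g'`
    (hΞ : ∀ i : ℤ, Ξ i ≫ W.d i - Y'.d (i + 1 + 1) ≫ Ξ (i + 1)
      = G (i + 1) ≫ h.f (i + 1) + g'.f (i + 1 + 1) ≫ H (i + 1))
    (Γ : ∀ i : ℤ, X'.X (i + 1 + 1 + 1) ⟶ W.X i)
    -- `Γ` satisfies `d Γ + Γ d = h ∘ Ψ - Ξ ∘ f'`
    (hΓ : ∀ i : ℤ, Γ i ≫ W.d i + X'.d (i + 1 + 1 + 1) ≫ Γ (i + 1)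
      = Ψ (i + 1) ≫ h.f (i + 1) - f'.f (i + 1 + 1 + 1) ≫ Ξ (i + 1)) :
    -- then `Γ∗` is a chain homotopy with `d Γ∗ + Γ∗ d = c ∘ F∗ - H∗ ∘ c'`
    ∀ i : ℤ, gammaHtpy f' h G Ψ Ξ Γ i ≫ (-(mappingCone h).d i)
        + (mappingCone f').d (i + 1 + 1) ≫ gammaHtpy f' h G Ψ Ξ Γ (i + 1)
      = coneInduced f' f u v F (i + 1 + 1) ≫ coneToConeShift f g h (i + 1)
        - coneToConeShift f' g' h' (i + 1) ≫ coneShiftInduced h' h w s H (i + 1) := by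
  intro i
  have e1 := hΞ i
  have e2 := hG (i + 1)
  have e3 := hΓ i
  have e4 := hΨ (i + 1)
  rw [sub_eq_iff_eq_add] at e1 e4
  rw [← eq_sub_iff_add_eq] at e2 e3
  have key : Biprod.ofComponents (-Ξ i) (G (i + 1)) (Γ i) (-Ψ (i + 1)) ≫
      (-Biprod.ofComponents (W.d i) 0 (h.f (i + 1)) (-Z.d (i + 1)))
      + Biprod.ofComponents (Y'.d (i + 1 + 1)) 0 (f'.f (i + 1 + 1 + 1)) (-X'.d (i + 1 + 1 + 1)) ≫
        Biprod.ofComponents (-Ξ (i + 1)) (G (i + 1 + 1)) (Γ (i + 1)) (-Ψ (i + 1 + 1))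
      = Biprod.ofComponents (v.f (i + 1 + 1)) 0 (-F (i + 1 + 1)) (u.f (i + 1 + 1 + 1)) ≫
          Biprod.ofComponents (0 : _ ⟶ W.X (i + 1)) (g.f (i + 1 + 1))
            (0 : X.X (i + 1 + 1 + 1) ⟶ W.X (i + 1)) 0
        - Biprod.ofComponents (0 : _ ⟶ W'.X (i + 1)) (g'.f (i + 1 + 1))
            (0 : X'.X (i + 1 + 1 + 1) ⟶ W'.X (i + 1)) 0 ≫
          Biprod.ofComponents (s.f (i + 1)) 0 (-H (i + 1)) (w.f (i + 1 + 1)) := by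
    rw [Preadditive.comp_neg]
    simp only [Biprod.ofComponents_comp]
    ext <;> simp [e1, e2, e3, e4] <;> abel
  exact key
end

section
/- Let k be a commutative ring and h, t ∈ k. Let C = k[x]/(x² − h·x − t), a free k-module with basis {1, x}, let μ : C ⊗_k C → C be the multiplication map, let Δ : C → C ⊗_k C be the k-linear map with Δ(1) = 1⊗x + x⊗1 − h·(1⊗1) and Δ(x) = x⊗x + t·(1⊗1), and let φ : C ⊗_k C → C ⊗_k C be the k-linear map determined by φ(a⊗b) = a⊗(x·b) − (a·x)⊗b. Then the sequence 0 → C →^{Δ} C ⊗_k C →^{φ} C ⊗_k C →^{μ} C → 0 is exact: Δ is injective, the image of Δ equals the kernel of φ, the image of φ equals the kernel of μ, and μ is surjective. -/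
open TensorProduct

/-- Khovanov's Frobenius algebra `C_{h,t} = k[x]/(x² - h·x - t)`. -/
noncomputable abbrev KhovanovAlg (k : Type*) [CommRing k] (h t : k) : Type _ :=
  AdjoinRoot (Polynomial.X ^ 2 - Polynomial.C h * Polynomial.X - Polynomial.C t)

/-- The class of `x` in `k[x]/(x² - h·x - t)`. -/
noncomputable def KhovanovAlg.x {k : Type*} [CommRing k] (h t : k) : KhovanovAlg k h t :=
  AdjoinRoot.root _

theorem KhovanovAlg.x_sq {k : Type*} [CommRing k] (h t : k) :
    KhovanovAlg.x h t * KhovanovAlg.x h t = h • KhovanovAlg.x h t + t • (1 : KhovanovAlg k h t) := by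
  have h1 := AdjoinRoot.eval₂_root
    (Polynomial.X ^ 2 - Polynomial.C h * Polynomial.X - Polynomial.C t)
  simp only [Polynomial.eval₂_sub, Polynomial.eval₂_mul, Polynomial.eval₂_pow, Polynomial.eval₂_X,
    Polynomial.eval₂_C] at h1
  rw [Algebra.smul_def, Algebra.smul_def, AdjoinRoot.algebraMap_eq]
  unfold KhovanovAlg.x
  linear_combination h1

theorem KhovanovAlg.exists_basis {k : Type*} [CommRing k] [Nontrivial k] (h t : k) :
    ∃ b : Module.Basis (Fin 2) k (KhovanovAlg k h t), b 0 = 1 ∧ b 1 = KhovanovAlg.x h t := by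
  have hd : (Polynomial.X ^ 2 - Polynomial.C h * Polynomial.X - Polynomial.C t).natDegree = 2 := by
    compute_degree!
  have hm : (Polynomial.X ^ 2 - Polynomial.C h * Polynomial.X - Polynomial.C t).Monic := by
    monicity!
  refine ⟨(AdjoinRoot.powerBasis' hm).basis.reindex (finCongr hd), ?_, ?_⟩
  · rw [Module.Basis.reindex_apply, PowerBasis.basis_eq_pow]
    exact pow_zero _
  · rw [Module.Basis.reindex_apply, PowerBasis.basis_eq_pow]
    exact pow_one _

theorem statement9 {k : Type*} [CommRing k] (h t : k)
    -- `μ` is the multiplication map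
    (μ : KhovanovAlg k h t ⊗[k] KhovanovAlg k h t →ₗ[k] KhovanovAlg k h t)
    (hμ : ∀ a b : KhovanovAlg k h t, μ (a ⊗ₜ[k] b) = a * b)
    -- `Δ` is the comultiplication
    (Δ : KhovanovAlg k h t →ₗ[k] KhovanovAlg k h t ⊗[k] KhovanovAlg k h t)
    (hΔ1 : Δ 1 = (1 : KhovanovAlg k h t) ⊗ₜ[k] KhovanovAlg.x h t
      + KhovanovAlg.x h t ⊗ₜ[k] (1 : KhovanovAlg k h t)
      - h • ((1 : KhovanovAlg k h t) ⊗ₜ[k] (1 : KhovanovAlg k h t)))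
    (hΔx : Δ (KhovanovAlg.x h t) = KhovanovAlg.x h t ⊗ₜ[k] KhovanovAlg.x h t
      + t • ((1 : KhovanovAlg k h t) ⊗ₜ[k] (1 : KhovanovAlg k h t)))
    -- `φ(a ⊗ b) = a ⊗ (x·b) - (a·x) ⊗ b`
    (φ : KhovanovAlg k h t ⊗[k] KhovanovAlg k h t →ₗ[k]
        KhovanovAlg k h t ⊗[k] KhovanovAlg k h t)
    (hφ : ∀ a b : KhovanovAlg k h t,
      φ (a ⊗ₜ[k] b) = a ⊗ₜ[k] (KhovanovAlg.x h t * b) - (a * KhovanovAlg.x h t) ⊗ₜ[k] b) :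
    -- the sequence `0 → C → C ⊗ C → C ⊗ C → C → 0` is exact
    Function.Injective Δ ∧ LinearMap.range Δ = LinearMap.ker φ ∧
      LinearMap.range φ = LinearMap.ker μ ∧ Function.Surjective μ := by
  rcases subsingleton_or_nontrivial k with hk | hk
  · have := Module.subsingleton k (KhovanovAlg k h t)
    have := Module.subsingleton k (KhovanovAlg k h t ⊗[k] KhovanovAlg k h t)
    exact ⟨Function.injective_of_subsingleton _, Subsingleton.elim _ _, Subsingleton.elim _ _,
      fun y => ⟨0, Subsingleton.elim _ _⟩⟩
  have hx := KhovanovAlg.x_sq h t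
  obtain ⟨b, hb0, hb1⟩ := KhovanovAlg.exists_basis h t
  generalize KhovanovAlg.x h t = x at *
  have hC : ∀ z : KhovanovAlg k h t, ∃ p q : k, z = p • 1 + q • x := fun z =>
    ⟨b.repr z 0, b.repr z 1, by
      conv_lhs => rw [← b.sum_repr z]
      simp only [Fin.sum_univ_two, hb0, hb1]⟩
  have hT : ∀ z : KhovanovAlg k h t ⊗[k] KhovanovAlg k h t, ∃ p q r s : k,
      z = p • (1 ⊗ₜ 1) + q • (1 ⊗ₜ x) + r • (x ⊗ₜ 1) + s • (x ⊗ₜ x) := fun z =>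
    ⟨(b.tensorProduct b).repr z (0, 0), (b.tensorProduct b).repr z (0, 1),
      (b.tensorProduct b).repr z (1, 0), (b.tensorProduct b).repr z (1, 1), by
      conv_lhs => rw [← (b.tensorProduct b).sum_repr z]
      simp only [Fintype.sum_prod_type, Fin.sum_univ_two, Module.Basis.tensorProduct_apply, hb0, hb1]
      abel⟩
  have hC0 : ∀ p q : k, p • (1 : KhovanovAlg k h t) + q • x = 0 → p = 0 ∧ q = 0 := by
    intro p q hpq
    have := Fintype.linearIndependent_iff.1 b.linearIndependent ![p, q]
      (by simpa [Fin.sum_univ_two, hb0, hb1] using hpq)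
    exact ⟨this 0, this 1⟩
  have hT0 : ∀ p q r s : k, p • ((1 : KhovanovAlg k h t) ⊗ₜ[k] (1 : KhovanovAlg k h t))
      + q • (1 ⊗ₜ x) + r • (x ⊗ₜ 1) + s • (x ⊗ₜ x) = 0 → p = 0 ∧ q = 0 ∧ r = 0 ∧ s = 0 := by
    intro p q r s hz
    have := Fintype.linearIndependent_iff.1 (b.tensorProduct b).linearIndependent
      (fun i => ![![p, q], ![r, s]] i.1 i.2)
      (by
        rw [← hz]
        simp only [Fintype.sum_prod_type, Fin.sum_univ_two, Module.Basis.tensorProduct_apply,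
          hb0, hb1]
        simp
        abel)
    exact ⟨this (0, 0), this (0, 1), this (1, 0), this (1, 1)⟩
  have hΔ : ∀ p q : k, Δ (p • 1 + q • x) = (q * t - p * h) • (1 ⊗ₜ 1) + p • (1 ⊗ₜ x)
      + p • (x ⊗ₜ 1) + q • (x ⊗ₜ x) := by
    intro p q
    rw [map_add, map_smul, map_smul, hΔ1, hΔx]
    module
  have hφ' : ∀ p q r s : k, φ (p • (1 ⊗ₜ 1) + q • (1 ⊗ₜ x) + r • (x ⊗ₜ 1) + s • (x ⊗ₜ x)) =
      (t * q - t * r) • (1 ⊗ₜ 1) + (p + h * q - t * s) • (1 ⊗ₜ x)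
      + (- p - h * r + t * s) • (x ⊗ₜ 1) + (r - q) • (x ⊗ₜ x) := by
    intro p q r s
    simp only [map_add, map_smul, hφ, hx, mul_one, one_mul, tmul_add, add_tmul, tmul_smul,
      ← smul_tmul']
    module
  have hμ' : ∀ p q r s : k, μ (p • (1 ⊗ₜ 1) + q • (1 ⊗ₜ x) + r • (x ⊗ₜ 1) + s • (x ⊗ₜ x)) =
      (p + t * s) • 1 + (q + r + h * s) • x := by
    intro p q r s
    simp only [map_add, map_smul, hμ, hx, mul_one, one_mul]
    module
  refine ⟨?_, ?_, ?_, fun y => ⟨1 ⊗ₜ y, by rw [hμ, one_mul]⟩⟩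
  · rw [injective_iff_map_eq_zero]
    intro z hz
    obtain ⟨p, q, rfl⟩ := hC z
    rw [hΔ] at hz
    obtain ⟨-, h1, -, h2⟩ := hT0 _ _ _ _ hz
    simp [h1, h2]
  · apply le_antisymm
    · rintro _ ⟨z, rfl⟩
      obtain ⟨p, q, rfl⟩ := hC z
      rw [LinearMap.mem_ker, hΔ, hφ']
      module
    · intro z hz
      obtain ⟨p, q, r, s, rfl⟩ := hT z
      rw [LinearMap.mem_ker, hφ'] at hz
      obtain ⟨-, h1, -, h2⟩ := hT0 _ _ _ _ hz
      refine ⟨q • 1 + s • x, ?_⟩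
      rw [hΔ]
      obtain rfl : r = q := sub_eq_zero.1 h2
      obtain rfl : p = s * t - r * h := by linear_combination h1
      rfl
  · apply le_antisymm
    · rintro _ ⟨z, rfl⟩
      obtain ⟨p, q, r, s, rfl⟩ := hT z
      rw [LinearMap.mem_ker, hφ', hμ']
      module
    · intro z hz
      obtain ⟨p, q, r, s, rfl⟩ := hT z
      rw [LinearMap.mem_ker, hμ'] at hz
      obtain ⟨h1, h2⟩ := hC0 _ _ hz
      refine ⟨q • (1 ⊗ₜ 1) + (0 : k) • (1 ⊗ₜ x) + s • (x ⊗ₜ 1) + (0 : k) • (x ⊗ₜ x), ?_⟩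
      rw [hφ']
      obtain rfl : p = - (t * s) := by linear_combination h1
      obtain rfl : r = - q - h * s := by linear_combination h2
      module
end

section
/- Let k be a commutative ring and h, t ∈ k. Let C = k[x]/(x² − h·x − t), let Δ : C → C ⊗_k C be the k-linear map with Δ(1) = 1⊗x + x⊗1 − h·(1⊗1) and Δ(x) = x⊗x + t·(1⊗1), and let φ : C ⊗_k C → C ⊗_k C be the k-linear map determined by φ(a⊗b) = a⊗(x·b) − (a·x)⊗b. Then the kernel of φ equals the image of Δ; explicitly, an element a·(1⊗1) + b·(1⊗x) + c·(x⊗1) + d·(x⊗x) (a,b,c,d ∈ k) lies in ker φ if and only if c = b and a = t·d − h·b, in which case it equals b·Δ(1) + d·Δ(x). -/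
open TensorProduct

theorem kh_basis {k : Type*} [CommRing k] [Nontrivial k] (h t : k) :
    ∃ B : Module.Basis (Fin 2) k (KhovanovAlg k h t), B 0 = 1 ∧ B 1 = KhovanovAlg.x h t := by
  have e : (Polynomial.X ^ 2 - Polynomial.C h * Polynomial.X - Polynomial.C t : Polynomial k)
      = Polynomial.X ^ 2 - (Polynomial.C h * Polynomial.X + Polynomial.C t) := by ring
  have hd : (Polynomial.C h * Polynomial.X + Polynomial.C t : Polynomial k).degree < (2 : ℕ) :=
    lt_of_le_of_lt Polynomial.degree_linear_le (by norm_num)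
  have hm : (Polynomial.X ^ 2 - Polynomial.C h * Polynomial.X - Polynomial.C t
      : Polynomial k).Monic := by
    rw [e]; exact Polynomial.monic_X_pow_sub (by simpa using hd)
  have hn : (Polynomial.X ^ 2 - Polynomial.C h * Polynomial.X - Polynomial.C t
      : Polynomial k).natDegree = 2 := by
    rw [e]
    compute_degree!
  let P := AdjoinRoot.powerBasis' hm
  have hP : P.dim = 2 := by simp [P, hn]
  refine ⟨P.basis.reindex (finCongr hP), ?_, ?_⟩
  · simp
  · simp [P, KhovanovAlg.x]

theorem kh_sq {k : Type*} [CommRing k] (h t : k) :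
    KhovanovAlg.x h t * KhovanovAlg.x h t = h • KhovanovAlg.x h t + t • 1 := by
  have := AdjoinRoot.eval₂_root
    (Polynomial.X ^ 2 - Polynomial.C h * Polynomial.X - Polynomial.C t : Polynomial k)
  simp only [Polynomial.eval₂_sub, Polynomial.eval₂_mul, Polynomial.eval₂_pow,
    Polynomial.eval₂_X, Polynomial.eval₂_C] at this
  rw [Algebra.smul_def, Algebra.smul_def, AdjoinRoot.algebraMap_eq]
  unfold KhovanovAlg.x
  linear_combination this

theorem kh_span {k : Type*} [CommRing k] (h t : k)
    (z : KhovanovAlg k h t ⊗[k] KhovanovAlg k h t) : ∃ a b c d : k,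
      z = a • ((1 : KhovanovAlg k h t) ⊗ₜ[k] (1 : KhovanovAlg k h t))
        + b • ((1 : KhovanovAlg k h t) ⊗ₜ[k] KhovanovAlg.x h t)
        + c • (KhovanovAlg.x h t ⊗ₜ[k] (1 : KhovanovAlg k h t))
        + d • (KhovanovAlg.x h t ⊗ₜ[k] KhovanovAlg.x h t) := by
  rcases subsingleton_or_nontrivial k with hk | hk
  · have := Module.subsingleton k (KhovanovAlg k h t ⊗[k] KhovanovAlg k h t)
    exact ⟨0, 0, 0, 0, Subsingleton.elim _ _⟩
  obtain ⟨B, h0, h1⟩ := kh_basis h t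
  have := (B.tensorProduct B).sum_repr z
  rw [Fintype.sum_prod_type] at this
  simp only [Fin.sum_univ_two, Module.Basis.tensorProduct_apply, h0, h1] at this
  exact ⟨_, _, _, _, by rw [← add_assoc] at this; exact this.symm⟩

theorem kh_indep {k : Type*} [CommRing k] (h t : k) (a b c d : k)
    (hz : a • ((1 : KhovanovAlg k h t) ⊗ₜ[k] (1 : KhovanovAlg k h t))
        + b • ((1 : KhovanovAlg k h t) ⊗ₜ[k] KhovanovAlg.x h t)
        + c • (KhovanovAlg.x h t ⊗ₜ[k] (1 : KhovanovAlg k h t))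
        + d • (KhovanovAlg.x h t ⊗ₜ[k] KhovanovAlg.x h t) = 0) :
    a = 0 ∧ b = 0 ∧ c = 0 ∧ d = 0 := by
  rcases subsingleton_or_nontrivial k with hk | hk
  · exact ⟨Subsingleton.elim _ _, Subsingleton.elim _ _, Subsingleton.elim _ _,
      Subsingleton.elim _ _⟩
  obtain ⟨B, h0, h1⟩ := kh_basis h t
  have := Fintype.linearIndependent_iff.1 (B.tensorProduct B).linearIndependent
    (fun p => (![![a, b], ![c, d]] : Fin 2 → Fin 2 → k) p.1 p.2) (by
      rw [Fintype.sum_prod_type]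
      simp only [Fin.sum_univ_two, Module.Basis.tensorProduct_apply, h0, h1]
      simpa [add_assoc] using hz)
  exact ⟨by simpa using this (0, 0), by simpa using this (0, 1), by simpa using this (1, 0),
    by simpa using this (1, 1)⟩

theorem statement10 {k : Type*} [CommRing k] (h t : k)
    -- `Δ` is the comultiplication
    (Δ : KhovanovAlg k h t →ₗ[k] KhovanovAlg k h t ⊗[k] KhovanovAlg k h t)
    (hΔ1 : Δ 1 = (1 : KhovanovAlg k h t) ⊗ₜ[k] KhovanovAlg.x h t
      + KhovanovAlg.x h t ⊗ₜ[k] (1 : KhovanovAlg k h t)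
      - h • ((1 : KhovanovAlg k h t) ⊗ₜ[k] (1 : KhovanovAlg k h t)))
    (hΔx : Δ (KhovanovAlg.x h t) = KhovanovAlg.x h t ⊗ₜ[k] KhovanovAlg.x h t
      + t • ((1 : KhovanovAlg k h t) ⊗ₜ[k] (1 : KhovanovAlg k h t)))
    -- `φ(a ⊗ b) = a ⊗ (x·b) - (a·x) ⊗ b`
    (φ : KhovanovAlg k h t ⊗[k] KhovanovAlg k h t →ₗ[k]
        KhovanovAlg k h t ⊗[k] KhovanovAlg k h t)
    (hφ : ∀ a b : KhovanovAlg k h t,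
      φ (a ⊗ₜ[k] b) = a ⊗ₜ[k] (KhovanovAlg.x h t * b) - (a * KhovanovAlg.x h t) ⊗ₜ[k] b) :
    -- the kernel of `φ` equals the image of `Δ`
    LinearMap.ker φ = LinearMap.range Δ ∧
    -- explicitly, in terms of the basis `{1⊗1, 1⊗x, x⊗1, x⊗x}` of `C ⊗ C`:
    ∀ a b c d : k,
      (a • ((1 : KhovanovAlg k h t) ⊗ₜ[k] (1 : KhovanovAlg k h t))
        + b • ((1 : KhovanovAlg k h t) ⊗ₜ[k] KhovanovAlg.x h t)
        + c • (KhovanovAlg.x h t ⊗ₜ[k] (1 : KhovanovAlg k h t))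
        + d • (KhovanovAlg.x h t ⊗ₜ[k] KhovanovAlg.x h t) ∈ LinearMap.ker φ
        ↔ (c = b ∧ a = t * d - h * b)) ∧
      ((c = b ∧ a = t * d - h * b) →
        a • ((1 : KhovanovAlg k h t) ⊗ₜ[k] (1 : KhovanovAlg k h t))
          + b • ((1 : KhovanovAlg k h t) ⊗ₜ[k] KhovanovAlg.x h t)
          + c • (KhovanovAlg.x h t ⊗ₜ[k] (1 : KhovanovAlg k h t))
          + d • (KhovanovAlg.x h t ⊗ₜ[k] KhovanovAlg.x h t)
        = b • Δ 1 + d • Δ (KhovanovAlg.x h t)) := by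
  have hform : ∀ a b c d : k,
      (c = b ∧ a = t * d - h * b) →
        a • ((1 : KhovanovAlg k h t) ⊗ₜ[k] (1 : KhovanovAlg k h t))
          + b • ((1 : KhovanovAlg k h t) ⊗ₜ[k] KhovanovAlg.x h t)
          + c • (KhovanovAlg.x h t ⊗ₜ[k] (1 : KhovanovAlg k h t))
          + d • (KhovanovAlg.x h t ⊗ₜ[k] KhovanovAlg.x h t)
        = b • Δ 1 + d • Δ (KhovanovAlg.x h t) := by
    rintro a b c d ⟨rfl, rfl⟩
    rw [hΔ1, hΔx]
    module
  have hker : ∀ a b c d : k,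
      (a • ((1 : KhovanovAlg k h t) ⊗ₜ[k] (1 : KhovanovAlg k h t))
        + b • ((1 : KhovanovAlg k h t) ⊗ₜ[k] KhovanovAlg.x h t)
        + c • (KhovanovAlg.x h t ⊗ₜ[k] (1 : KhovanovAlg k h t))
        + d • (KhovanovAlg.x h t ⊗ₜ[k] KhovanovAlg.x h t) ∈ LinearMap.ker φ
        ↔ (c = b ∧ a = t * d - h * b)) := by
    intro a b c d
    have key : φ (a • ((1 : KhovanovAlg k h t) ⊗ₜ[k] (1 : KhovanovAlg k h t))
        + b • ((1 : KhovanovAlg k h t) ⊗ₜ[k] KhovanovAlg.x h t)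
        + c • (KhovanovAlg.x h t ⊗ₜ[k] (1 : KhovanovAlg k h t))
        + d • (KhovanovAlg.x h t ⊗ₜ[k] KhovanovAlg.x h t)) =
        (b * t - c * t) • ((1 : KhovanovAlg k h t) ⊗ₜ[k] (1 : KhovanovAlg k h t))
        + (a + b * h - t * d) • ((1 : KhovanovAlg k h t) ⊗ₜ[k] KhovanovAlg.x h t)
        + (t * d - a - c * h) • (KhovanovAlg.x h t ⊗ₜ[k] (1 : KhovanovAlg k h t))
        + (c - b) • (KhovanovAlg.x h t ⊗ₜ[k] KhovanovAlg.x h t) := by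
      simp only [map_add, map_smul, hφ, kh_sq, mul_one, one_mul, TensorProduct.tmul_add, TensorProduct.add_tmul,
        TensorProduct.tmul_smul, ← TensorProduct.smul_tmul']
      module
    rw [LinearMap.mem_ker, key]
    constructor
    · intro hz
      obtain ⟨-, h2, -, h4⟩ := kh_indep h t _ _ _ _ hz
      exact ⟨sub_eq_zero.1 h4, by linear_combination h2⟩
    · rintro ⟨rfl, rfl⟩
      module
  refine ⟨?_, fun a b c d => ⟨hker a b c d, hform a b c d⟩⟩
  apply le_antisymm
  · intro z hz
    obtain ⟨a, b, c, d, rfl⟩ := kh_span h t z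
    rw [hform a b c d ((hker a b c d).1 hz)]
    exact ⟨b • 1 + d • KhovanovAlg.x h t, by simp only [map_add, map_smul]⟩
  · rintro _ ⟨y, rfl⟩
    obtain ⟨b, d, rfl⟩ : ∃ b d : k, y = b • 1 + d • KhovanovAlg.x h t := by
      rcases subsingleton_or_nontrivial k with hk | hk
      · have := Module.subsingleton k (KhovanovAlg k h t)
        exact ⟨0, 0, Subsingleton.elim _ _⟩
      obtain ⟨B, h0, h1⟩ := kh_basis h t
      have := B.sum_repr y
      simp only [Fin.sum_univ_two, h0, h1] at this
      exact ⟨_, _, this.symm⟩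
    rw [map_add, map_smul, map_smul, ← hform (t * d - h * b) b b d ⟨rfl, rfl⟩]
    exact (hker _ _ _ _).2 ⟨rfl, rfl⟩
end
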